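/- arXiv:1504.06169 — 2 statements merged into one kernel-verified Lean document; each statement's English description precedes it below -/
import Mathlib

section
/- If an arithmetic matroid admitting a basis of multiplicity 1 is representable by an integer matrix A (whose columns represent the elements, with multiplicity of a subset I given by the product of the invariant factors of the submatrix A(I)), then the representing matrix is unique up to reversing the signs of individual column vectors and up to a unimodular change of basis of the ambient lattice. -/
/-! STATEMENT 0: An arithmetic matroid admitting a basis of matroidMultiplicity 1 has (if
representable) a unique integer-matrix representation, up to sign reversal of the
column vectors and a unimodular change of basis of the ambient lattice. -/

/-- The `j`-th column of an integer matrix, as a vector of `ℤ^d`. -/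
def column {d n : ℕ} (A : Matrix (Fin d) (Fin n) ℤ) (j : Fin n) : Fin d → ℤ :=
  fun r => A r j

/-- The matroidMultiplicity of a subset `I` of columns of `A`: the product of the invariant
factors of the submatrix `A(I)`, i.e. the cardinality of the torsion subgroup of the
cokernel `ℤ^d / ⟨columns of A(I)⟩`. -/
noncomputable def matroidMultiplicity {d n : ℕ} (A : Matrix (Fin d) (Fin n) ℤ)
    (I : Finset (Fin n)) : ℕ :=
  Nat.card (Submodule.torsion ℤ
    ((Fin d → ℤ) ⧸ Submodule.span ℤ (column A '' (I : Set (Fin n)))))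

/-- The columns indexed by `I` are linearly independent over `ℚ` (the underlying
matroid of the arithmetic matroid represented by `A` is the `ℚ`-dependency matroid
of the columns). -/
def ColsIndep {d n : ℕ} (A : Matrix (Fin d) (Fin n) ℤ) (I : Finset (Fin n)) : Prop :=
  LinearIndependent ℚ (fun j : I => fun r : Fin d => (A r j : ℚ))

theorem det_snoc_eq_of_support {l : ℕ} (M : Matrix (Fin (l + 2)) (Fin (l + 1)) ℤ)
    (z : Fin (l + 2) → ℤ) (hz : ∀ a, a ≠ 0 → a ≠ Fin.last (l + 1) → z a = 0) :
    (Matrix.of fun a => (Fin.snoc (M a) (z a) : Fin (l + 2) → ℤ)).det =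
      (-1) ^ (l + 1) * z 0 * (M.submatrix Fin.succ id).det +
        z (Fin.last _) * (M.submatrix Fin.castSucc id).det := by
  rw [Matrix.det_succ_column _ (Fin.last (l + 1)),
    Finset.sum_eq_add 0 (Fin.last (l + 1)) (by simp [Fin.ext_iff])]
  · congr 1
    · simp only [Matrix.of_apply, Fin.snoc_last, Fin.val_zero, Fin.val_last, zero_add]
      congr 2
      ext a b
      simp
    · simp only [Matrix.of_apply, Fin.snoc_last, Fin.val_last, ← two_mul, pow_mul]
      simp only [neg_one_sq, one_pow, one_mul]
      congr 2
      ext a b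
      simp
  · intro a _ ha
    simp [hz a ha.1 ha.2]
  · simp
  · simp

/-- Rows are adjacent when some column has nonzero entries in both. -/
def rowGraph {R C : Type*} (X : Matrix R C ℤ) : SimpleGraph R where
  Adj i i' := i ≠ i' ∧ ∃ c, X i c ≠ 0 ∧ X i' c ≠ 0
  symm := ⟨fun _ _ ⟨h, c, h₁, h₂⟩ => ⟨h.symm, c, h₂, h₁⟩⟩
  loopless := ⟨fun _ h => h.1 rfl⟩

theorem dist_getVert_of_length_eq_dist {V : Type*} {G : SimpleGraph V} {u v : V} (p : G.Walk u v)
    (hp : p.length = G.dist u v) {a : ℕ} (ha : a ≤ p.length) :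
    G.dist u (p.getVert a) = a ∧ G.dist (p.getVert a) v = p.length - a := by
  have h₁ := SimpleGraph.dist_le (p.take a)
  have h₂ := SimpleGraph.dist_le (p.drop a)
  have h₃ := (p.take a).reachable.dist_triangle_left v
  simp only [SimpleGraph.Walk.take_length, SimpleGraph.Walk.drop_length] at h₁ h₂
  omega

theorem le_succ_of_adj_getVert {V : Type*} {G : SimpleGraph V} {u v : V} (p : G.Walk u v)
    (hp : p.length = G.dist u v) {a b : ℕ} (ha : a ≤ p.length) (hb : b ≤ p.length)
    (h : G.Adj (p.getVert a) (p.getVert b)) : b ≤ a + 1 := by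
  have h₁ := (dist_getVert_of_length_eq_dist p hp ha).1
  have h₂ := (dist_getVert_of_length_eq_dist p hp hb).1
  have h₃ := (p.take a).reachable.dist_triangle_left (p.getVert b)
  rw [SimpleGraph.dist_eq_one_iff_adj.2 h] at h₃
  omega

theorem getVert_injective_of_length_eq_dist {V : Type*} {G : SimpleGraph V} {u v : V}
    (p : G.Walk u v) (hp : p.length = G.dist u v) {a b : ℕ} (ha : a ≤ p.length)
    (hb : b ≤ p.length) (h : p.getVert a = p.getVert b) : a = b := by
  rw [← (dist_getVert_of_length_eq_dist p hp ha).1, h,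
    (dist_getVert_of_length_eq_dist p hp hb).1]

theorem mul_eq_mul_of_reachable_rowGraph {R C : Type*} (X : Matrix R C ℤ) (x y : R → ℤ)
    (hxy : ∀ i, x i ^ 2 = y i ^ 2)
    (hdet : ∀ (k : ℕ) (f : Fin (k + 1) → R) (g : Fin k → C), Function.Injective f →
      (Matrix.of fun a => (Fin.snoc (fun b => X (f a) (g b)) (x (f a)) : Fin (k + 1) → ℤ)).det ^ 2 =
      (Matrix.of fun a =>
        (Fin.snoc (fun b => X (f a) (g b)) (y (f a)) : Fin (k + 1) → ℤ)).det ^ 2)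
    {i i' : R} (h : (rowGraph X).Reachable i i') (hi : x i ≠ 0) (hi' : x i' ≠ 0) :
    y i * x i' = y i' * x i := by
  obtain ⟨p, hp⟩ := h.exists_walk_length_eq_dist
  induction hk : p.length using Nat.strong_induction_on generalizing i i' with
  | _ k ih =>
  obtain _ | l := k
  · obtain rfl := SimpleGraph.Walk.eq_of_length_eq_zero hk
    ring
  by_cases hmid : ∃ a, a ≠ 0 ∧ a < l + 1 ∧ x (p.getVert a) ≠ 0
  · obtain ⟨a, ha0, hal, hxa⟩ := hmid
    have hd := dist_getVert_of_length_eq_dist p hp (a := a) (by omega)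
    have e₁ := ih a hal (p.take a).reachable hi hxa (p.take a)
      (by simp [SimpleGraph.Walk.take_length, hd.1]; omega)
      (by simp [SimpleGraph.Walk.take_length]; omega)
    have e₂ := ih (l + 1 - a) (by omega) (p.drop a).reachable hxa hi' (p.drop a)
      (by simp [SimpleGraph.Walk.drop_length, hd.2])
      (by simp [SimpleGraph.Walk.drop_length]; omega)
    apply mul_left_cancel₀ hxa
    linear_combination x i' * e₁ + x i * e₂
  · push Not at hmid
    have hadj : ∀ b : Fin (l + 1), ∃ c, X (p.getVert b) c ≠ 0 ∧ X (p.getVert (b + 1)) c ≠ 0 :=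
      fun b => (p.adj_getVert_succ (by omega)).2
    choose g hg using hadj
    have hinj : ∀ a b, a ≤ l + 1 → b ≤ l + 1 → p.getVert a = p.getVert b → a = b :=
      fun a b ha hb => getVert_injective_of_length_eq_dist p hp (by omega) (by omega)
    have hzero : ∀ (a : ℕ) (b : Fin (l + 1)), a ≤ l + 1 → a ≠ b → a ≠ b + 1 →
        X (p.getVert a) (g b) = 0 := by
      intro a b ha h₁ h₂
      by_contra hne
      have n₁ : (rowGraph X).Adj (p.getVert a) (p.getVert (b + 1)) :=
        ⟨fun e => h₂ (hinj _ _ ha (by omega) e), g b, hne, (hg b).2⟩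
      have n₂ : (rowGraph X).Adj (p.getVert b) (p.getVert a) :=
        ⟨fun e => h₁ (hinj _ _ (by omega) ha e).symm, g b, (hg b).1, hne⟩
      have := le_succ_of_adj_getVert p hp (by omega) (by omega) n₁
      have := le_succ_of_adj_getVert p hp (by omega) (by omega) n₂
      omega
    have hD := hdet (l + 1) (fun a => p.getVert a) g
      (fun a b e => Fin.ext (hinj _ _ (by omega) (by omega) e))
    let M : Matrix (Fin (l + 2)) (Fin (l + 1)) ℤ := fun a b => X (p.getVert a) (g b)
    have hxz : ∀ a : Fin (l + 2), a ≠ 0 → a ≠ Fin.last (l + 1) → x (p.getVert a) = 0 :=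
      fun a h₁ h₂ => hmid a (fun h => h₁ (Fin.ext h))
        (by have := a.2; have := Fin.val_ne_of_ne h₂; rw [Fin.val_last] at this; omega)
    have hyz : ∀ a : Fin (l + 2), a ≠ 0 → a ≠ Fin.last (l + 1) → y (p.getVert a) = 0 :=
      fun a h₁ h₂ => pow_eq_zero_iff two_ne_zero |>.1 <| by
        rw [← hxy, hxz a h₁ h₂, zero_pow two_ne_zero]
    have hDx := det_snoc_eq_of_support M (fun a => x (p.getVert a)) hxz
    have hDy := det_snoc_eq_of_support M (fun a => y (p.getVert a)) hyz
    have hlast : p.getVert (l + 1) = i' := by rw [← hk, SimpleGraph.Walk.getVert_length]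
    simp only [Fin.val_zero, Fin.val_last, SimpleGraph.Walk.getVert_zero, hlast] at hDx hDy
    have hP : (M.submatrix Fin.succ id).det ≠ 0 := by
      rw [Matrix.det_of_isUpperTriangular, Finset.prod_ne_zero_iff]
      · intro b _
        exact (hg b).2
      · intro a b hab
        have : (b : ℕ) < a := hab
        exact hzero _ _ (by simp; omega) (by simp; omega) (by simp; omega)
    have hQ : (M.submatrix Fin.castSucc id).det ≠ 0 := by
      rw [Matrix.det_of_isLowerTriangular, Finset.prod_ne_zero_iff]
      · intro b _
        exact (hg b).1
      · intro a b hab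
        have : (a : ℕ) < b := hab
        exact hzero _ _ (by simp) (by simp; omega) (by simp; omega)
    change (Matrix.of fun a => (Fin.snoc (M a) _ : Fin (l + 2) → ℤ)).det ^ 2 =
      (Matrix.of fun a => (Fin.snoc (M a) _ : Fin (l + 2) → ℤ)).det ^ 2 at hD
    rw [hDx, hDy] at hD
    generalize (M.submatrix Fin.succ id).det = P at *
    generalize (M.submatrix Fin.castSucc id).det = Q at *
    have hs : ((-1 : ℤ) ^ (l + 1)) ^ 2 = 1 := by rw [← pow_mul, mul_comm, pow_mul, neg_one_sq, one_pow]
    generalize (-1 : ℤ) ^ (l + 1) = s at *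
    have hs0 : s ≠ 0 := by
      rintro rfl
      simp at hs
    have e : x i * x i' = y i * y i' := by
      apply mul_left_cancel₀ (mul_ne_zero (mul_ne_zero (mul_ne_zero two_ne_zero hs0) hP) hQ)
      linear_combination hD - s ^ 2 * P ^ 2 * hxy i - Q ^ 2 * hxy i'
    apply mul_left_cancel₀ hi
    linear_combination y i * e - y i' * hxy i

theorem exists_units_of_sq_minors_eq {R C : Type*} (X Y : Matrix R C ℤ)
    (hminor : ∀ (k : ℕ) (f : Fin k → R) (g : Fin k → C), Function.Injective f →
      (X.submatrix f g).det ^ 2 = (Y.submatrix f g).det ^ 2) (T : Finset C) :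
    ∃ (α : R → ℤˣ) (β : C → ℤˣ), ∀ i, ∀ j ∈ T, Y i j = α i * X i j * β j := by
  classical
  induction T using Finset.induction_on with
  | empty => exact ⟨1, 1, by simp⟩
  | insert c T hc ih =>
  obtain ⟨α, β, hαβ⟩ := ih
  have hsq : ∀ u : ℤˣ, (u : ℤ) * u = 1 := fun u => by
    rw [← Units.val_mul, Int.units_mul_self, Units.val_one]
  let X' : Matrix R T ℤ := X.submatrix id Subtype.val
  have hXY : ∀ i, ∀ j ∈ T, X i j = α i * Y i j * β j := fun i j hj => by
    rw [hαβ i j hj]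
    linear_combination -X i j * hsq (α i) * β j * β j - X i j * hsq (β j)
  have hentry : ∀ i, X i c ^ 2 = (α i * Y i c) ^ 2 := fun i => by
    have := hminor 1 (fun _ => i) (fun _ => c) (Function.injective_of_subsingleton _)
    simp only [Matrix.det_unique, Matrix.submatrix_apply] at this
    linear_combination this - Y i c ^ 2 * hsq (α i)
  have key := fun i i' => mul_eq_mul_of_reachable_rowGraph (i := i) (i' := i') X'
    (fun i => X i c) (fun i => α i * Y i c) hentry (by
      intro k f g hf
      let g' : Fin (k + 1) → C := Fin.snoc (fun b => (g b : C)) c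
      have h₁ : (Matrix.of fun a =>
          (Fin.snoc (fun b => X' (f a) (g b)) (X (f a) c) : Fin (k + 1) → ℤ)) =
          X.submatrix f g' := by
        ext a b
        refine Fin.lastCases ?_ (fun b => ?_) b <;> simp [g', X']
      have h₂ : (Matrix.of fun a =>
          (Fin.snoc (fun b => X' (f a) (g b)) (α (f a) * Y (f a) c) : Fin (k + 1) → ℤ)) =
          Matrix.of fun a b => ((α (f a) : ℤˣ) : ℤ) * (Matrix.of fun a b =>
            (((Fin.snoc (fun b => β (g b)) 1 : Fin (k + 1) → ℤˣ) b : ℤˣ) : ℤ) *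
              Y.submatrix f g' a b) a b := by
        ext a b
        refine Fin.lastCases ?_ (fun b => ?_) b
        · simp [g']
        · simp [g', X', hXY _ _ (g b).2]
          ring
      rw [h₁, h₂, Matrix.det_mul_column, Matrix.det_mul_row, hminor _ _ _ hf]
      simp only [← Units.coe_prod]
      rw [mul_pow, mul_pow, sq (Units.val _), hsq, sq (Units.val _), hsq, one_mul, one_mul])
  have hcomp : ∀ K : (rowGraph X').ConnectedComponent, ∃ γ : ℤˣ,
      ∀ i, (rowGraph X').connectedComponentMk i = K → α i * Y i c = γ * X i c := by
    intro K
    have hzero : ∀ i, X i c = 0 → α i * Y i c = 0 := fun i hi => by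
      simpa [hi] using (hentry i).symm
    by_cases hK : ∃ i, (rowGraph X').connectedComponentMk i = K ∧ X i c ≠ 0
    · obtain ⟨i, hi, hx⟩ := hK
      obtain ⟨γ, hγ⟩ : ∃ γ : ℤˣ, α i * Y i c = γ * X i c := by
        rcases sq_eq_sq_iff_eq_or_eq_neg.1 (hentry i) with h | h
        · exact ⟨1, by simp [h]⟩
        · exact ⟨-1, by simp [h]⟩
      refine ⟨γ, fun i' hi' => ?_⟩
      by_cases hx' : X i' c = 0
      · rw [hzero i' hx', hx', mul_zero]
      · have := key i i' (SimpleGraph.ConnectedComponent.exact (hi.trans hi'.symm)) hx hx'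
        apply mul_left_cancel₀ hx
        linear_combination -this + X i' c * hγ
    · push Not at hK
      exact ⟨1, fun i hi => by rw [hzero i (hK i hi), hK i hi, mul_zero]⟩
  choose γ hγ using hcomp
  have hcol : ∀ j, ∃ δ : ℤˣ, j ∈ T → ∀ i, X i j ≠ 0 →
      γ ((rowGraph X').connectedComponentMk i) = δ := by
    intro j
    by_cases hj : ∃ i, X i j ≠ 0
    · obtain ⟨i, hi⟩ := hj
      refine ⟨γ ((rowGraph X').connectedComponentMk i), fun hjT i' hi' => ?_⟩
      by_cases hii : i' = i
      · rw [hii]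
      · exact congrArg γ (SimpleGraph.ConnectedComponent.sound
          (SimpleGraph.Adj.reachable ⟨hii, ⟨j, hjT⟩, hi', hi⟩))
    · push Not at hj
      exact ⟨1, fun _ i hi => absurd (hj i) hi⟩
  choose δ hδ using hcol
  refine ⟨fun i => α i * γ ((rowGraph X').connectedComponentMk i),
    fun j => if j = c then 1 else β j * δ j, fun i j hj => ?_⟩
  rcases Finset.mem_insert.1 hj with rfl | hjT
  · have := hγ _ i rfl
    simp only [if_true, Units.val_mul, Units.val_one]
    linear_combination α i * this - Y i j * hsq (α i)
  · have hjc : j ≠ c := fun h => hc (h ▸ hjT)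
    simp only [if_neg hjc, hαβ i j hjT]
    by_cases hx : X i j = 0
    · simp [hx]
    · rw [hδ j hjT i hx]
      push_cast
      linear_combination -(α i * X i j * β j) * hsq (δ j)

theorem exists_det_submatrix_eq_det_submatrix {R C : Type*} [Fintype R] [DecidableEq R]
    (e : R → C) {k : ℕ} {f : Fin k → R} (hf : Function.Injective f) (g : Fin k → C) :
    ∃ h : R → C, ∀ X : Matrix R C ℤ, X.submatrix id e = 1 →
      (X.submatrix id h).det = (X.submatrix f g).det := by
  classical
  refine ⟨Function.extend f g e, fun X hX => ?_⟩
  have hX' : ∀ i j, X i (e j) = (1 : Matrix R R ℤ) i j := fun i j => congrFun (congrFun hX i) j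
  obtain ⟨p, hp⟩ : ∃ p : R → Prop, ∀ i, p i ↔ ∃ a, f a = i := ⟨_, fun _ => Iff.rfl⟩
  rw [Matrix.twoBlockTriangular_det' _ p]
  · have h₁ : (X.submatrix id (Function.extend f g e)).toSquareBlockProp (fun i => ¬ p i) = 1 := by
      ext i j
      simp only [Matrix.toSquareBlockProp_def, Matrix.of_apply, Matrix.submatrix_apply, id]
      rw [Function.extend_apply' _ _ _ (mt (hp _).2 j.2), hX', Matrix.one_apply, Matrix.one_apply]
      simp only [Subtype.ext_iff]
    let φ : Fin k ≃ {i // p i} :=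
      (Equiv.ofInjective f hf).trans (Equiv.subtypeEquivRight fun i => (hp i).symm)
    rw [h₁, Matrix.det_one, mul_one, ← Matrix.det_submatrix_equiv_self φ]
    congr 1
    ext a b
    change X (f a) (Function.extend f g e (f b)) = X (f a) (g b)
    rw [hf.extend_apply]
  · intro i hi j hj
    rw [Matrix.submatrix_apply, Function.extend_apply' _ _ _ (mt (hp _).2 hj), hX', id,
      Matrix.one_apply_ne]
    rintro rfl
    exact hj hi

theorem linearIndependent_rat_cols_iff {d n : ℕ} (A : Matrix (Fin d) (Fin n) ℤ)
    (h : Fin d → Fin n) :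
    LinearIndependent ℚ (fun a => fun r => (A r (h a) : ℚ)) ↔ (A.submatrix id h).det ≠ 0 := by
  have := Matrix.linearIndependent_cols_iff_isUnit
    (A := (A.submatrix id h).map (Int.castRingHom ℚ))
  rw [Matrix.isUnit_iff_isUnit_det, isUnit_iff_ne_zero, ← RingHom.mapMatrix_apply,
    ← RingHom.map_det, eq_intCast, Int.cast_ne_zero] at this
  exact this

theorem colsIndep_image_iff {d n : ℕ} (A : Matrix (Fin d) (Fin n) ℤ) {h : Fin d → Fin n}
    (hh : Function.Injective h) :
    ColsIndep A (Finset.univ.image h) ↔ (A.submatrix id h).det ≠ 0 := by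
  rw [← linearIndependent_rat_cols_iff]
  let φ : Fin d ≃ (Finset.univ.image h : Finset (Fin n)) :=
    Equiv.ofBijective (fun a => ⟨h a, Finset.mem_image_of_mem _ (Finset.mem_univ a)⟩)
      ⟨fun a b hab => hh (Subtype.ext_iff.1 hab), fun ⟨c, hc⟩ => by
        obtain ⟨a, -, rfl⟩ := Finset.mem_image.1 hc
        exact ⟨a, rfl⟩⟩
  exact (linearIndependent_equiv' φ rfl).symm

theorem matroidMultiplicity_image {d n : ℕ} (A : Matrix (Fin d) (Fin n) ℤ) {h : Fin d → Fin n}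
    (hA : (A.submatrix id h).det ≠ 0) :
    matroidMultiplicity A (Finset.univ.image h) = (A.submatrix id h).det.natAbs := by
  have hli : LinearIndependent ℤ (fun a => column A (h a)) :=
    Matrix.linearIndependent_cols_of_det_ne_zero hA
  have hspan : column A '' ((Finset.univ.image h : Finset (Fin n)) : Set (Fin n)) =
      Set.range fun a => column A (h a) := by
    rw [Finset.coe_image, Finset.coe_univ, Set.image_univ, ← Set.range_comp]
    rfl
  have hcard := Submodule.natAbs_det_basis_change (Pi.basisFun ℤ (Fin d)) _
    (Module.Basis.span hli)
  have hdet : (Pi.basisFun ℤ (Fin d)).det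
      (Subtype.val ∘ Module.Basis.span hli) = (A.submatrix id h).det := by
    rw [Module.Basis.det_apply]
    congr 1
    ext i j
    simp [Module.Basis.toMatrix_apply, Module.Basis.span_apply, column]
  rw [hdet] at hcard
  rw [matroidMultiplicity, hspan, hcard]
  have htop : Submodule.torsion ℤ
      ((Fin d → ℤ) ⧸ Submodule.span ℤ (Set.range fun a => column A (h a))) = ⊤ := by
    rw [eq_top_iff]
    intro x _
    have h0 : (Nat.card ((Fin d → ℤ) ⧸
        Submodule.span ℤ (Set.range fun a => column A (h a))) : ℤ) ≠ 0 := by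
      rw [← hcard]
      exact_mod_cast Int.natAbs_ne_zero.2 hA
    refine (Submodule.mem_torsion_iff _).2 ⟨⟨_, mem_nonZeroDivisors_of_ne_zero h0⟩, ?_⟩
    rw [Submonoid.mk_smul, natCast_zsmul]
    exact card_nsmul_eq_zero'
  rw [htop]
  exact Nat.card_congr Submodule.topEquiv.toEquiv

theorem sq_det_submatrix_eq {d n : ℕ} {A B : Matrix (Fin d) (Fin n) ℤ}
    (hdep : ∀ I : Finset (Fin n), ColsIndep A I ↔ ColsIndep B I)
    (hmult : ∀ I : Finset (Fin n), matroidMultiplicity A I = matroidMultiplicity B I)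
    (h : Fin d → Fin n) :
    (A.submatrix id h).det ^ 2 = (B.submatrix id h).det ^ 2 := by
  by_cases hh : Function.Injective h
  · have hd := hdep (Finset.univ.image h)
    rw [colsIndep_image_iff A hh, colsIndep_image_iff B hh] at hd
    by_cases hA : (A.submatrix id h).det = 0
    · rw [hA, not_not.1 (mt hd.2 (not_not.2 hA))]
    · have hm := hmult (Finset.univ.image h)
      rw [matroidMultiplicity_image A hA, matroidMultiplicity_image B (hd.1 hA)] at hm
      exact Int.natAbs_eq_iff_sq_eq.1 hm
  · obtain ⟨a, b, hab, hne⟩ := Function.not_injective_iff.1 hh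
    rw [Matrix.det_zero_of_column_eq hne (fun i => by simp [hab]),
      Matrix.det_zero_of_column_eq hne (fun i => by simp [hab])]

/-- Suppose the integer matrices `A` and `B` represent the same
arithmetic matroid (same `ℚ`-dependency matroid on the columns and same matroidMultiplicity
function), and this arithmetic matroid has a basis of matroidMultiplicity `1` (a set of `d`
`ℚ`-independent columns whose submatrix has trivial cokernel torsion, i.e. determinant
`±1`).  Then `B` is obtained from `A` by a unimodular change of basis of the lattice
`ℤ^d` together with a reversal of the signs of some of the columns. -/
theorem arithmetic_matroid_representation_unique {d n : ℕ}
    (A B : Matrix (Fin d) (Fin n) ℤ)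
    (hdep : ∀ I : Finset (Fin n), ColsIndep A I ↔ ColsIndep B I)
    (hmult : ∀ I : Finset (Fin n), matroidMultiplicity A I = matroidMultiplicity B I)
    (hbasis : ∃ I : Finset (Fin n), I.card = d ∧ ColsIndep A I ∧ matroidMultiplicity A I = 1) :
    ∃ (U : Matrix (Fin d) (Fin d) ℤ) (ε : Fin n → ℤ),
      IsUnit U.det ∧ (∀ j, ε j = 1 ∨ ε j = -1) ∧
      B = U * A * Matrix.diagonal ε := by
  obtain ⟨I, hcard, hindep, hone⟩ := hbasis
  obtain ⟨e, he, rfl⟩ : ∃ e : Fin d → Fin n, Function.Injective e ∧ Finset.univ.image e = I :=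
    ⟨I.orderEmbOfFin hcard, (I.orderEmbOfFin hcard).injective,
      Finset.image_orderEmbOfFin_univ I hcard⟩
  have hsq := sq_det_submatrix_eq hdep hmult
  rw [matroidMultiplicity_image A ((colsIndep_image_iff A he).1 hindep)] at hone
  have hA : IsUnit (A.submatrix id e).det := Int.isUnit_iff_natAbs_eq.2 hone
  have hB : IsUnit (B.submatrix id e).det := by
    rw [Int.isUnit_iff_natAbs_eq, ← hone]
    exact Int.natAbs_eq_iff_sq_eq.2 (hsq e).symm
  set A₀ := A.submatrix id e with hA₀
  set B₀ := B.submatrix id e with hB₀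
  have hsub : ∀ (P : Matrix (Fin d) (Fin d) ℤ) (Q : Matrix (Fin d) (Fin n) ℤ)
      (h : Fin d → Fin n), (P * Q).submatrix id h = P * Q.submatrix id h := fun _ _ _ => rfl
  have hunit : ∀ {P : Matrix (Fin d) (Fin d) ℤ}, IsUnit P.det → P⁻¹.det ^ 2 = 1 := fun h => by
    rcases Int.isUnit_iff.1 (Matrix.isUnit_nonsing_inv_det _ h) with h | h <;> simp [h]
  obtain ⟨α, β, hαβ⟩ := exists_units_of_sq_minors_eq (A₀⁻¹ * A) (B₀⁻¹ * B) (by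
    intro k f g hf
    obtain ⟨h, hh⟩ := exists_det_submatrix_eq_det_submatrix e hf g
    rw [← hh _ (by rw [hsub, ← hA₀, Matrix.nonsing_inv_mul _ hA]),
      ← hh _ (by rw [hsub, ← hB₀, Matrix.nonsing_inv_mul _ hB]), hsub, hsub, Matrix.det_mul,
      Matrix.det_mul, mul_pow, mul_pow, hunit hA, hunit hB, hsq]) Finset.univ
  refine ⟨B₀ * Matrix.diagonal (fun i => (α i : ℤ)) * A₀⁻¹, fun j => β j, ?_,
    fun j => Int.isUnit_iff.1 (β j).isUnit, ?_⟩
  · rw [Matrix.det_mul, Matrix.det_mul, Matrix.det_diagonal, ← Units.coe_prod]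
    exact (hB.mul (Units.isUnit _)).mul (Matrix.isUnit_nonsing_inv_det _ hA)
  · have hmat : B₀⁻¹ * B = Matrix.diagonal (fun i => (α i : ℤ)) * (A₀⁻¹ * A) *
        Matrix.diagonal (fun j => (β j : ℤ)) := by
      ext i j
      rw [Matrix.mul_diagonal, Matrix.diagonal_mul, hαβ i j (Finset.mem_univ j)]
    rw [← Matrix.mul_nonsing_inv_cancel_left _ B hB, hmat]
    simp only [Matrix.mul_assoc]
end

section
/- Let A be a nonempty finite central complexified real arrangement of hyperplanes and let N, Z, P be disjoint subsets of A. If the subposet Δ(A; N, Z, P) of the face poset, consisting of all faces F with σ_F(H) = -1 for H ∈ N, σ_F(H) = 0 for H ∈ Z, and σ_F(H) = +1 for H ∈ P, is nonempty, then its order complex is contractible. -/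
/-! STATEMENT 5: For a nonempty finite central complexified real arrangement `A` and
pairwise disjoint subsets `N, Z, P ⊆ A`, the subposet `Δ(A; N, Z, P)` of the face poset
(faces with prescribed signs on `N`, `Z`, `P`) has contractible order complex, provided
it is nonempty. -/

open CategoryTheory

/-- The value at `x` of the defining linear form of the `i`-th hyperplane. -/
def evalForm {d : ℕ} {ι : Type} (a : ι → Fin d → ℝ) (i : ι) (x : Fin d → ℝ) : ℝ :=
  ∑ k, a i k * x k

/-- `σ` is the sign vector of a face of the central arrangement with forms `a`. -/
def IsFace {d : ℕ} {ι : Type} (a : ι → Fin d → ℝ) (σ : ι → SignType) : Prop :=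
  ∃ x : Fin d → ℝ, ∀ i, SignType.sign (evalForm a i x) = σ i

/-- The subposet `Δ(A; N, Z, P)` of the face poset: faces `F` with `σ_F ≡ -1` on `N`,
`σ_F ≡ 0` on `Z` and `σ_F ≡ +1` on `P`, ordered by the face order (componentwise, with
`0 < ±1` and `+1, -1` incomparable). -/
def DeltaPoset {d : ℕ} {ι : Type} (a : ι → Fin d → ℝ) (N Z P : Set ι) : Type :=
  {σ : ι → SignType // IsFace a σ ∧ (∀ i ∈ N, σ i = -1) ∧ (∀ i ∈ Z, σ i = 0) ∧
    (∀ i ∈ P, σ i = 1)}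

instance {d : ℕ} {ι : Type} (a : ι → Fin d → ℝ) (N Z P : Set ι) :
    PartialOrder (DeltaPoset a N Z P) where
  le σ τ := ∀ i, σ.1 i = 0 ∨ σ.1 i = τ.1 i
  le_refl σ i := Or.inr rfl
  le_trans σ τ ρ h h' i := by
    rcases h i with h0 | he
    · exact Or.inl h0
    · rcases h' i with h0 | he'
      · exact Or.inl (he.trans h0)
      · exact Or.inr (he.trans he')
  le_antisymm σ τ h h' := by
    apply Subtype.ext; funext i
    rcases h i with h0 | he
    · rcases h' i with h0' | he'
      · exact h0.trans h0'.symm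
      · exact he'.symm
    · exact he

section AbsoluteExtensor

/-- `Y` is an absolute extensor for closed subspaces of `X`: continuous maps into `Y` extend from
closed subsets of `X` to larger closed subsets. -/
def IsAbsoluteExtensor (X : Type*) {E : Type*} [TopologicalSpace X] [TopologicalSpace E]
    (Y : Set E) : Prop :=
  ∀ (A D : Set X) (f : X → E), IsClosed A → IsClosed D → A ⊆ D → ContinuousOn f A →
    Set.MapsTo f A Y → ∃ g : X → E, ContinuousOn g D ∧ Set.MapsTo g D Y ∧ Set.EqOn g f A

lemma IsAbsoluteExtensor.union {X E : Type*} [PseudoEMetricSpace X] [TopologicalSpace E]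
    {U V : Set E} (hUc : IsClosed U) (hVc : IsClosed V) (hU : IsAbsoluteExtensor X U)
    (hV : IsAbsoluteExtensor X V) (hUV : IsAbsoluteExtensor X (U ∩ V)) :
    IsAbsoluteExtensor X (U ∪ V) := by
  classical
  intro A D f hA hD hAD hf hfm
  let AU := A ∩ f ⁻¹' U
  let AV := A ∩ f ⁻¹' V
  have hAU : IsClosed AU := hf.preimage_isClosed_of_isClosed hA hUc
  have hAV : IsClosed AV := hf.preimage_isClosed_of_isClosed hA hVc
  let XU := D ∩ {x | Metric.infEDist x AU ≤ Metric.infEDist x AV}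
  let XV := D ∩ {x | Metric.infEDist x AV ≤ Metric.infEDist x AU}
  have hXU : IsClosed XU :=
    hD.inter (isClosed_le Metric.continuous_infEDist Metric.continuous_infEDist)
  have hXV : IsClosed XV :=
    hD.inter (isClosed_le Metric.continuous_infEDist Metric.continuous_infEDist)
  have hD' : XU ∪ XV = D := by
    rw [← Set.inter_union_distrib_left, Set.inter_eq_left]
    exact fun x _ => le_total (Metric.infEDist x AU) (Metric.infEDist x AV)
  have hAUX : AU ⊆ XU := fun x hx =>
    ⟨hAD hx.1, by simp [Metric.infEDist_zero_of_mem hx]⟩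
  have hAVX : AV ⊆ XV := fun x hx =>
    ⟨hAD hx.1, by simp [Metric.infEDist_zero_of_mem hx]⟩
  have hAUV : AU ∩ XV ⊆ AV := fun x hx => by
    have h := hx.2.2
    rw [Set.mem_ofPred_eq, Metric.infEDist_zero_of_mem hx.1, nonpos_iff_eq_zero] at h
    exact (Metric.mem_iff_infEDist_zero_of_closed hAV).2 h
  have hAVU : AV ∩ XU ⊆ AU := fun x hx => by
    have h := hx.2.2
    rw [Set.mem_ofPred_eq, Metric.infEDist_zero_of_mem hx.1, nonpos_iff_eq_zero] at h
    exact (Metric.mem_iff_infEDist_zero_of_closed hAU).2 h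
  obtain ⟨g₀, hg₀c, hg₀m, hg₀e⟩ := hUV (A ∩ (XU ∩ XV)) (XU ∩ XV) f
    (hA.inter (hXU.inter hXV)) (hXU.inter hXV) Set.inter_subset_right
    (hf.mono Set.inter_subset_left) (by
      rintro x ⟨hxA, hxU, hxV⟩
      rcases hfm hxA with h | h
      · exact ⟨h, (hAUV ⟨⟨hxA, h⟩, hxV⟩).2⟩
      · exact ⟨(hAVU ⟨⟨hxA, h⟩, hxU⟩).2, h⟩)
  let f' : X → E := (XU ∩ XV).piecewise g₀ f
  have hf'f : Set.EqOn f' f A := by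
    intro x hx
    by_cases h : x ∈ XU ∩ XV
    · exact (Set.piecewise_eq_of_mem _ _ _ h).trans (hg₀e ⟨hx, h⟩)
    · exact Set.piecewise_eq_of_notMem _ _ _ h
  have hf'g : Set.EqOn f' g₀ (XU ∩ XV) := Set.piecewise_eqOn _ _ _
  have hf'A : ContinuousOn f' A := hf.congr hf'f
  have hf'X : ContinuousOn f' (XU ∩ XV) := hg₀c.congr hf'g
  obtain ⟨gU, hgUc, hgUm, hgUe⟩ := hU (AU ∪ XU ∩ XV) XU f' (hAU.union (hXU.inter hXV)) hXU
    (Set.union_subset hAUX Set.inter_subset_left)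
    ((hf'A.mono Set.inter_subset_left).union_of_isClosed hf'X hAU (hXU.inter hXV)) (by
      rintro x (hx | hx)
      · rw [hf'f hx.1]
        exact hx.2
      · rw [hf'g hx]
        exact (hg₀m hx).1)
  obtain ⟨gV, hgVc, hgVm, hgVe⟩ := hV (AV ∪ XU ∩ XV) XV f' (hAV.union (hXU.inter hXV)) hXV
    (Set.union_subset hAVX Set.inter_subset_right)
    ((hf'A.mono Set.inter_subset_left).union_of_isClosed hf'X hAV (hXU.inter hXV)) (by
      rintro x (hx | hx)
      · rw [hf'f hx.1]
        exact hx.2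
      · rw [hf'g hx]
        exact (hg₀m hx).2)
  let g : X → E := XU.piecewise gU gV
  have hgU : Set.EqOn g gU XU := Set.piecewise_eqOn _ _ _
  have hgV : Set.EqOn g gV XV := by
    intro x hx
    by_cases h : x ∈ XU
    · rw [hgU h, hgUe (Or.inr ⟨h, hx⟩), hgVe (Or.inr ⟨h, hx⟩)]
    · exact Set.piecewise_eq_of_notMem _ _ _ h
  refine ⟨g, ?_, ?_, ?_⟩
  · rw [← hD']
    exact (hgUc.congr hgU).union_of_isClosed (hgVc.congr hgV) hXU hXV
  · rw [← hD']
    rintro x (hx | hx)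
    · rw [hgU hx]
      exact Or.inl (hgUm hx)
    · rw [hgV hx]
      exact Or.inr (hgVm hx)
  · intro x hx
    rcases hfm hx with h | h
    · rw [hgU (hAUX ⟨hx, h⟩), hgUe (Or.inl ⟨hx, h⟩), hf'f hx]
    · rw [hgV (hAVX ⟨hx, h⟩), hgVe (Or.inl ⟨hx, h⟩), hf'f hx]

/-- A retract of a finite-dimensional coordinate space is an absolute extensor. -/
lemma IsAbsoluteExtensor.of_retraction {X ι : Type*} [TopologicalSpace X] [NormalSpace X]
    {Y : Set (ι → ℝ)} (r : (ι → ℝ) → ι → ℝ) (hr : Continuous r)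
    (hrY : ∀ t, r t ∈ Y) (hrr : ∀ t ∈ Y, r t = t) : IsAbsoluteExtensor X Y := by
  intro A D f hA _ _ hf hfm
  obtain ⟨g, hg⟩ := ContinuousMap.exists_restrict_eq hA ⟨A.domRestrict f, hf.domRestrict⟩
  refine ⟨r ∘ g, (hr.comp g.continuous).continuousOn, fun x _ => hrY _, fun x hx => ?_⟩
  have h : g x = f x := congrArg (fun k => k ⟨x, hx⟩) hg
  rw [Function.comp_apply, h, hrr _ (hfm hx)]

lemma IsAbsoluteExtensor.contractibleSpace {E : Type*} [AddCommGroup E] [Module ℝ E]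
    [TopologicalSpace E] [IsTopologicalAddGroup E] [ContinuousSMul ℝ E] {Y : Set E}
    (hY : IsAbsoluteExtensor (E × ℝ) Y) (hYc : IsClosed Y) (hne : Y.Nonempty) :
    ContractibleSpace Y := by
  obtain ⟨c, hc⟩ := hne
  obtain ⟨g, hgc, hgm, hge⟩ := hY (Y ×ˢ {0, 1}) (Y ×ˢ Set.univ)
    (fun w => (1 - w.2) • w.1 + w.2 • c) (hYc.prod (Set.toFinite _).isClosed)
    (hYc.prod isClosed_univ) (Set.prod_mono_right (Set.subset_univ _))
    (Continuous.continuousOn (by fun_prop)) (by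
      rintro ⟨t, u⟩ ⟨ht, hu | hu⟩
      · simp only [] at hu
        simpa [hu] using ht
      · simp only [Set.mem_singleton_iff] at hu
        simpa [hu] using hc)
  rw [contractible_iff_id_nullhomotopic]
  refine ⟨⟨c, hc⟩, ⟨⟨⟨fun w => ⟨g (w.2.1, w.1), hgm ⟨w.2.2, trivial⟩⟩, ?_⟩, ?_, ?_⟩⟩⟩
  · refine Continuous.subtype_mk (hgc.comp_continuous (by fun_prop) fun w => ?_) _
    exact ⟨w.2.2, trivial⟩
  · intro t
    apply Subtype.ext
    change g (t.1, 0) = t.1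
    rw [hge ⟨t.2, by simp⟩]
    simp
  · intro t
    apply Subtype.ext
    change g (t.1, 1) = c
    rw [hge ⟨t.2, by simp⟩]
    simp

end AbsoluteExtensor

section OrderComplexCoordinates

variable {P : Type} [PartialOrder P] [Fintype P]

/-- The order complex of the subposet `S` of the finite poset `P`, in barycentric coordinates. -/
def orderComplex (S : Set P) : Set (P → ℝ) :=
  {t | t ∈ stdSimplex ℝ P ∧ IsChain (· ≤ ·) {i | t i ≠ 0} ∧ {i | t i ≠ 0} ⊆ S}

lemma isClosed_orderComplex (S : Set P) : IsClosed (orderComplex S) := by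
  have : orderComplex S = stdSimplex ℝ P ∩
      ((⋂ i : P, ⋂ j : P, {t | ¬ (i ≤ j ∨ j ≤ i) → t i * t j = 0}) ∩
        ⋂ i : P, {t | i ∉ S → t i = 0}) := by
    ext t
    simp only [orderComplex, Set.mem_ofPred_eq, Set.mem_inter_iff, Set.mem_iInter, mul_eq_zero]
    refine and_congr_right fun _ => and_congr ⟨fun h i j hij => ?_, fun h i hi j hj _ => ?_⟩
      ⟨fun h i hi => ?_, fun h i hi => ?_⟩
    · by_contra! h0
      exact hij (h.total (x := i) (y := j) h0.1 h0.2)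
    · by_contra hij
      exact (h i j hij).elim hi hj
    · by_contra h0
      exact hi (h h0)
    · by_contra h0
      exact hi (h i h0)
  rw [this]
  refine (isClosed_stdSimplex ℝ P).inter ((isClosed_iInter fun i => isClosed_iInter fun j => ?_).inter
    (isClosed_iInter fun i => ?_))
  · by_cases hij : i ≤ j ∨ j ≤ i
    · simp [hij]
    · simp only [hij, not_false_eq_true, forall_const]
      exact isClosed_eq (by fun_prop) (by fun_prop)
  · by_cases hi : i ∈ S
    · simp [hi]
    · simp only [hi, not_false_eq_true, forall_const]
      exact isClosed_eq (by fun_prop) (by fun_prop)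

lemma single_mem_orderComplex [DecidableEq P] {S : Set P} {c : P} (hc : c ∈ S) :
    Pi.single c 1 ∈ orderComplex S := by
  have h : {i | (Pi.single c 1 : P → ℝ) i ≠ 0} ⊆ {c} := fun i hi => by
    by_contra hic
    exact hi (Pi.single_eq_of_ne hic 1)
  exact ⟨single_mem_stdSimplex ℝ c, Set.subsingleton_singleton.isChain.mono h,
    h.trans (Set.singleton_subset_iff.2 hc)⟩

lemma orderComplex_inter (S T : Set P) :
    orderComplex (S ∩ T) = orderComplex S ∩ orderComplex T := by
  ext t
  simp only [orderComplex, Set.mem_ofPred_eq, Set.mem_inter_iff, Set.subset_inter_iff]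
  tauto

lemma orderComplex_union {S T : Set P}
    (h : ∀ C : Set P, IsChain (· ≤ ·) C → C ⊆ S ∪ T → C ⊆ S ∨ C ⊆ T) :
    orderComplex (S ∪ T) = orderComplex S ∪ orderComplex T := by
  ext t
  simp only [orderComplex, Set.mem_ofPred_eq, Set.mem_union]
  constructor
  · rintro ⟨h1, h2, h3⟩
    exact (h _ h2 h3).imp (fun h4 => ⟨h1, h2, h4⟩) (fun h4 => ⟨h1, h2, h4⟩)
  · rintro (⟨h1, h2, h3⟩ | ⟨h1, h2, h3⟩)
    · exact ⟨h1, h2, h3.trans Set.subset_union_left⟩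
    · exact ⟨h1, h2, h3.trans Set.subset_union_right⟩

lemma IsAbsoluteExtensor.orderComplex_union {X : Type*} [PseudoEMetricSpace X] {S T : Set P}
    (h : ∀ C : Set P, IsChain (· ≤ ·) C → C ⊆ S ∪ T → C ⊆ S ∨ C ⊆ T)
    (hS : IsAbsoluteExtensor X (orderComplex S)) (hT : IsAbsoluteExtensor X (orderComplex T))
    (hST : IsAbsoluteExtensor X (orderComplex (S ∩ T))) :
    IsAbsoluteExtensor X (orderComplex (S ∪ T)) := by
  rw [_root_.orderComplex_union h]
  rw [orderComplex_inter] at hST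
  exact hS.union (isClosed_orderComplex S) (isClosed_orderComplex T) hT hST

lemma isAbsoluteExtensor_orderComplex_of_isChain (X : Type*) [TopologicalSpace X] [NormalSpace X]
    {S : Set P} (hS : IsChain (· ≤ ·) S) {c : P} (hc : c ∈ S) :
    IsAbsoluteExtensor X (orderComplex S) := by
  classical
  let u : (P → ℝ) → P → ℝ := fun t i => if i ∈ S then max (t i) 0 else 0
  let s : (P → ℝ) → ℝ := fun t => ∑ i, u t i
  have hu : ∀ t i, 0 ≤ u t i := fun t i => by
    simp only [u]
    split_ifs <;> simp
  have huS : ∀ t i, i ∉ S → u t i = 0 := fun t i hi => by simp [u, hi]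
  have huc : Continuous u := by
    refine continuous_pi fun i => ?_
    by_cases hi : i ∈ S
    · simp only [u, hi, if_true]
      fun_prop
    · simp only [u, hi, if_false]
      fun_prop
  have hsc : Continuous s := by
    refine continuous_finsetSum _ fun i _ => ?_
    exact (continuous_apply i).comp huc
  have hpos : ∀ t, 0 < max (s t) 1 := fun t => lt_max_of_lt_right one_pos
  refine IsAbsoluteExtensor.of_retraction
    (fun t => (max (s t) 1)⁻¹ • (u t + max (1 - s t) 0 • Pi.single c 1)) ?_ ?_ ?_
  · refine Continuous.smul ((hsc.max continuous_const).inv₀ fun t => (hpos t).ne') ?_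
    exact huc.add (((continuous_const.sub hsc).max continuous_const).smul continuous_const)
  · intro t
    have hsub : {i | ((max (s t) 1)⁻¹ • (u t + max (1 - s t) 0 • (Pi.single c 1 : P → ℝ))) i ≠ 0}
        ⊆ S := by
      intro i hi
      by_contra hiS
      apply hi
      have : i ≠ c := fun h => hiS (h ▸ hc)
      simp [huS t i hiS, this]
    refine ⟨⟨fun i => ?_, ?_⟩, hS.mono hsub, hsub⟩
    · have : 0 ≤ (Pi.single c 1 : P → ℝ) i := by
        by_cases h : i = c
        · subst h; simp
        · simp [h]
      simp only [Pi.smul_apply, Pi.add_apply, smul_eq_mul]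
      have := hu t i
      have := hpos t
      positivity
    · simp only [Pi.smul_apply, Pi.add_apply, smul_eq_mul, ← Finset.mul_sum,
        Finset.sum_add_distrib, Finset.sum_pi_single', Finset.mem_univ, if_true, mul_one]
      rw [inv_mul_eq_one₀ (hpos t).ne']
      change max (s t) 1 = s t + max (1 - s t) 0
      rcases le_total (s t) 1 with h | h
      · rw [max_eq_right h, max_eq_left (by linarith)]
        ring
      · rw [max_eq_left h, max_eq_right (by linarith)]
        ring
  · intro t ht
    have hut : u t = t := by
      ext i
      by_cases hi : i ∈ S
      · simp [u, hi, ht.1.1 i]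
      · by_contra h
        exact hi (ht.2.2 fun h0 => h (by simp [u, hi, h0]))
    have hst : s t = 1 := by
      simp only [s, hut]
      exact ht.1.2
    simp [hut, hst]

lemma isAbsoluteExtensor_orderComplex_of_isGreatest (X : Type*) [PseudoEMetricSpace X]
    {S : Set P} {c : P} (hc : IsGreatest S c) : IsAbsoluteExtensor X (orderComplex S) := by
  induction h : S.ncard using Nat.strong_induction_on generalizing S with | _ n ih
  by_cases hS : IsChain (· ≤ ·) S
  · exact isAbsoluteExtensor_orderComplex_of_isChain X hS hc.1
  · obtain ⟨x, hx, y, hy, hxy⟩ : ∃ x ∈ S, ∃ y ∈ S, ¬ (x ≤ y ∨ y ≤ x) := by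
      by_contra! h0
      exact hS fun x hx y hy _ => h0 x hx y hy
    have hxc : c ≠ x := by
      rintro rfl
      exact hxy (Or.inr (hc.2 hy))
    have hyc : c ≠ y := by
      rintro rfl
      exact hxy (Or.inl (hc.2 hx))
    have hne : x ≠ y := fun h => hxy (Or.inl h.le)
    have key : ∀ T ⊆ S, ∀ z ∈ S, z ∉ T → c ∈ T → IsAbsoluteExtensor X (orderComplex T) :=
      fun T hT z hz hzT hcT => ih _ (h ▸ Set.ncard_lt_ncard (hT.ssubset_of_mem_notMem hz hzT))
        ⟨hcT, fun z hz => hc.2 (hT hz)⟩ rfl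
    have hunion : S \ {x} ∪ S \ {y} = S := by
      ext z
      simp only [Set.mem_union, Set.mem_sdiff, Set.mem_singleton_iff]
      refine ⟨fun h => h.elim And.left And.left, fun hz => ?_⟩
      by_cases hzx : z = x
      · exact Or.inr ⟨hz, fun hzy => hne (hzx.symm.trans hzy)⟩
      · exact Or.inl ⟨hz, hzx⟩
    rw [← hunion]
    refine IsAbsoluteExtensor.orderComplex_union (fun C hC hCS => ?_)
      (key _ Set.sdiff_subset x hx (fun h0 => h0.2 rfl) ⟨hc.1, hxc⟩)
      (key _ Set.sdiff_subset y hy (fun h0 => h0.2 rfl) ⟨hc.1, hyc⟩)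
      (key _ (Set.inter_subset_left.trans Set.sdiff_subset)
        x hx (fun h0 => h0.1.2 rfl) ⟨⟨hc.1, hxc⟩, ⟨hc.1, hyc⟩⟩)
    rw [hunion] at hCS
    by_cases hxC : x ∈ C
    · refine Or.inr fun z hz => ⟨hCS hz, ?_⟩
      rintro rfl
      exact hxy (hC.total hxC hz)
    · refine Or.inl fun z hz => ⟨hCS hz, ?_⟩
      rintro rfl
      exact hxC hz

end OrderComplexCoordinates

section OrderComplex
open Opposite

variable {P : Type} [PartialOrder P]

/-- The characteristic map of the simplex of the nerve given by a monotone map. -/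
noncomputable def nerveSimplex {n : ℕ} (x : Fin (n + 1) →o P) :
    C(stdSimplex ℝ (Fin (n + 1)), SSet.toTop.obj (nerve P)) :=
  TopCat.toSSetObjEquiv _ (op (.mk n))
    ((sSetTopAdj.unit.app (nerve P)).app (op (.mk n)) x.monotone.functor)

lemma nerveSimplex_comp {n m : ℕ} (x : Fin (n + 1) →o P) (s : Fin (m + 1) →o Fin (n + 1))
    (p : stdSimplex ℝ (Fin (m + 1))) :
    nerveSimplex (x.comp s) p = nerveSimplex x (stdSimplex.map s p) := by
  have h := ConcreteCategory.congr_hom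
    ((sSetTopAdj.unit.app (nerve P)).naturality (SimplexCategory.mkHom s).op) x.monotone.functor
  have h2 := TopCat.toSSetObjEquiv_naturality_apply (SimplexCategory.mkHom s)
    ((sSetTopAdj.unit.app (nerve P)).app (op (.mk n)) x.monotone.functor) p
  refine Eq.trans ?_ h2
  exact congrArg (fun z => TopCat.toSSetObjEquiv _ (op (.mk m)) z p) h

lemma toTop_nerve_hom_ext {Y : TopCat} {f g : SSet.toTop.obj (nerve P) ⟶ Y}
    (h : ∀ (n : ℕ) (x : Fin (n + 1) →o P) (p : stdSimplex ℝ (Fin (n + 1))),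
      f (nerveSimplex x p) = g (nerveSimplex x p)) : f = g := by
  apply (sSetTopAdj.homEquiv _ _).injective
  ext ⟨n⟩ x
  induction n using SimplexCategory.rec with | _ n
  apply (TopCat.toSSetObjEquiv _ _).injective
  ext p
  have h' := h n ⟨x.obj, x.monotone⟩ p
  rw [Adjunction.homEquiv_unit, Adjunction.homEquiv_unit]
  exact h'

lemma exists_nerveSimplex_eq (z : SSet.toTop.obj (nerve P)) :
    ∃ (n : ℕ) (x : Fin (n + 1) →o P) (p : stdSimplex ℝ (Fin (n + 1))),
      nerveSimplex x p = z := by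
  let S : Set (SSet.toTop.obj (nerve P)) := {z | ∃ (n : ℕ) (x : Fin (n + 1) →o P)
    (p : stdSimplex ℝ (Fin (n + 1))), nerveSimplex x p = z}
  let _ : TopologicalSpace Prop := ⊤
  let f : SSet.toTop.obj (nerve P) ⟶ TopCat.of Prop :=
    TopCat.ofHom ⟨fun z => z ∈ S, continuous_top⟩
  let g : SSet.toTop.obj (nerve P) ⟶ TopCat.of Prop :=
    TopCat.ofHom ⟨fun z => True, continuous_top⟩
  have hfg : f = g := toTop_nerve_hom_ext fun n x p => eq_true ⟨n, x, p, rfl⟩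
  exact of_eq_true (ConcreteCategory.congr_hom hfg z)

variable [Fintype P]

/-- The simplices of the nerve, as affine simplices in the standard simplex on the poset. -/
noncomputable def nerveToSingular : nerve P ⟶ TopCat.toSSet.obj (TopCat.of (stdSimplex ℝ P)) where
  app n := ↾fun x => (TopCat.toSSetObjEquiv (TopCat.of (stdSimplex ℝ P)) n).symm
    ⟨fun p => stdSimplex.map x.obj p, stdSimplex.continuous_map _⟩
  naturality m n f := by
    ext x
    apply (TopCat.toSSetObjEquiv (TopCat.of (stdSimplex ℝ P)) n).injective
    refine ContinuousMap.ext fun p => ?_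
    exact (stdSimplex.map_comp_apply _ x.obj p).symm

/-- Barycentric coordinates on the realization of the nerve of a finite poset. -/
noncomputable def nerveCoord :
    SSet.toTop.obj (nerve P) ⟶ TopCat.of (stdSimplex ℝ P) :=
  (sSetTopAdj.homEquiv _ _).symm nerveToSingular

lemma nerveCoord_nerveSimplex {n : ℕ} (x : Fin (n + 1) →o P)
    (p : stdSimplex ℝ (Fin (n + 1))) :
    nerveCoord (nerveSimplex x p) = stdSimplex.map x p := by
  have h : sSetTopAdj.unit.app (nerve P) ≫ TopCat.toSSet.map nerveCoord = nerveToSingular :=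
    (Adjunction.homEquiv_unit _ _ _ _).symm.trans
      ((sSetTopAdj.homEquiv _ _).apply_symm_apply nerveToSingular)
  have h2 := ConcreteCategory.congr_hom (NatTrans.congr_app h (op (.mk n))) x.monotone.functor
  exact congrArg (fun z => TopCat.toSSetObjEquiv (TopCat.of (stdSimplex ℝ P)) (op (.mk n)) z p) h2


omit [PartialOrder P] in
lemma stdSimplex_map_congr {Q : Type} [Fintype Q] {f g : P → Q} (p : stdSimplex ℝ P)
    (h : ∀ i, p i ≠ 0 → f i = g i) : stdSimplex.map f p = stdSimplex.map g p := by
  classical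
  ext j
  simp only [stdSimplex.map_coe, FunOnFinite.linearMap_apply_apply, Finset.sum_filter]
  refine Finset.sum_congr rfl fun i _ => ?_
  by_cases hi : p i = 0
  · simp [hi]
  · rw [h i hi]

omit [PartialOrder P] in
lemma stdSimplex_map_ne_zero_iff {Q : Type} [Fintype Q] (f : P → Q) (p : stdSimplex ℝ P)
    (j : Q) : stdSimplex.map f p j ≠ 0 ↔ ∃ i, p i ≠ 0 ∧ f i = j := by
  classical
  rw [stdSimplex.map_coe, FunOnFinite.linearMap_apply_apply, Ne,
    Finset.sum_eq_zero_iff_of_nonneg (fun i _ => stdSimplex.zero_le p i)]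
  simp only [Finset.mem_filter, Finset.mem_univ, true_and, not_forall]
  exact ⟨fun ⟨i, h, h'⟩ => ⟨i, h', h⟩, fun ⟨i, h, h'⟩ => ⟨i, h', h⟩⟩

omit [PartialOrder P] in
lemma stdSimplex_exists_ne_zero (p : stdSimplex ℝ P) : ∃ i, p i ≠ 0 := by
  by_contra! h
  have := stdSimplex.sum_eq_one p
  simp [h] at this

omit [Fintype P] in
lemma nerveSimplex_congr {n : ℕ} {x x' : Fin (n + 1) →o P} (p : stdSimplex ℝ (Fin (n + 1)))
    (h : ∀ i, p i ≠ 0 → x i = x' i) : nerveSimplex x p = nerveSimplex x' p := by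
  classical
  obtain ⟨i₀, hi₀⟩ := stdSimplex_exists_ne_zero p
  let T : Finset (Fin (n + 1)) := {i | p i ≠ 0}
  have hT : T.Nonempty := ⟨i₀, by simpa [T] using hi₀⟩
  let F : Fin (n + 1) → Finset (Fin (n + 1)) := fun i => insert (T.min' hT) {j ∈ T | j ≤ i}
  let s : Fin (n + 1) →o Fin (n + 1) :=
    ⟨fun i => (F i).sup id, fun i j hij => Finset.sup_mono
      (Finset.insert_subset_insert _ fun k hk => by
        simp only [Finset.mem_filter] at hk ⊢
        exact ⟨hk.1, hk.2.trans hij⟩)⟩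
  have hsT : ∀ i, s i ∈ T := by
    intro i
    obtain ⟨k, hk, hk'⟩ := Finset.exists_mem_eq_sup (F i) ⟨_, Finset.mem_insert_self _ _⟩ id
    change (F i).sup id ∈ T
    rw [hk']
    rcases Finset.mem_insert.1 hk with rfl | hk
    · exact T.min'_mem hT
    · exact (Finset.mem_filter.1 hk).1
  have hs : ∀ i ∈ T, s i = i := by
    intro i hi
    change (F i).sup id = i
    refine le_antisymm (Finset.sup_le fun k hk => ?_)
      (Finset.le_sup (s := F i) (f := id) ?_)
    · rcases Finset.mem_insert.1 hk with rfl | hk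
      · exact T.min'_le i hi
      · exact (Finset.mem_filter.1 hk).2
    · exact Finset.mem_insert_of_mem (Finset.mem_filter.2 ⟨hi, le_rfl⟩)
  have hp : stdSimplex.map s p = p := by
    conv_rhs => rw [← stdSimplex.map_id_apply p]
    exact stdSimplex_map_congr p fun i hi => hs i (by simpa [T] using hi)
  have hx : x.comp s = x'.comp s := by
    ext i
    exact h _ (by simpa [T] using hsT i)
  rw [← hp, ← nerveSimplex_comp, ← nerveSimplex_comp, hx]

lemma nerveSimplex_eq_of_reference {n m : ℕ} (x : Fin (n + 1) →o P)
    (p : stdSimplex ℝ (Fin (n + 1))) (y : Fin (m + 1) →o P) (T : Finset (Fin (m + 1)))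
    (h : ∀ i, p i ≠ 0 → ∃ j ∈ T, y j = x i) :
    ∃ q : stdSimplex ℝ (Fin (m + 1)), nerveSimplex x p = nerveSimplex y q ∧
      ∀ j, (j ∈ T ∧ (∀ k ∈ T, y k = y j → k ≤ j) → q j = stdSimplex.map x p (y j)) ∧
        (¬ (j ∈ T ∧ ∀ k ∈ T, y k = y j → k ≤ j) → q j = 0) := by
  classical
  let F : Fin (n + 1) → Finset (Fin (m + 1)) := fun i => {j ∈ T | y j ≤ x i}
  let s : Fin (n + 1) →o Fin (m + 1) :=
    ⟨fun i => (F i).sup id, fun i j hij => Finset.sup_mono fun k hk => by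
        simp only [F, Finset.mem_filter] at hk ⊢
        exact ⟨hk.1, hk.2.trans (x.monotone hij)⟩⟩
  have hle : ∀ i, ∀ j ∈ T, y j ≤ x i → j ≤ s i := fun i j hj hji =>
    Finset.le_sup (f := id) (Finset.mem_filter.2 ⟨hj, hji⟩)
  have hs : ∀ i, p i ≠ 0 → s i ∈ T ∧ y (s i) = x i := by
    intro i hi
    obtain ⟨j, hj, hji⟩ := h i hi
    obtain ⟨k, hk, hk'⟩ := Finset.exists_mem_eq_sup (F i)
      ⟨j, Finset.mem_filter.2 ⟨hj, hji.le⟩⟩ id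
    have hk'' : s i = k := hk'
    obtain ⟨hkT, hkx⟩ := Finset.mem_filter.1 hk
    rw [hk'']
    refine ⟨hkT, le_antisymm hkx ?_⟩
    rw [← hji, ← hk'']
    exact y.monotone (hle i j hj hji.le)
  refine ⟨stdSimplex.map s p, ?_, fun j => ⟨?_, ?_⟩⟩
  · rw [← nerveSimplex_comp]
    exact nerveSimplex_congr p fun i hi => (hs i hi).2.symm
  · rintro ⟨hj, hmax⟩
    simp only [stdSimplex.map_coe, FunOnFinite.linearMap_apply_apply, Finset.sum_filter]
    refine Finset.sum_congr rfl fun i _ => ?_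
    by_cases hi : p i = 0
    · simp [hi]
    · obtain ⟨hT, hy⟩ := hs i hi
      have : s i = j ↔ x i = y j := by
        refine ⟨fun h => by rw [← hy, h], fun h => ?_⟩
        exact le_antisymm (hmax _ hT (hy.trans h)) (hle i j hj h.ge)
      simp only [this]
  · intro hj
    by_contra h0
    obtain ⟨i, hi, rfl⟩ := (stdSimplex_map_ne_zero_iff _ _ _).1 h0
    obtain ⟨hT, hy⟩ := hs i hi
    exact hj ⟨hT, fun k hk hky => hle i k hk (hky.trans hy).le⟩

lemma nerveSimplex_eq_of_map_eq {n m : ℕ} {x : Fin (n + 1) →o P} {p : stdSimplex ℝ (Fin (n + 1))}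
    {y : Fin (m + 1) →o P} {q : stdSimplex ℝ (Fin (m + 1))}
    (h : stdSimplex.map x p = stdSimplex.map y q) : nerveSimplex x p = nerveSimplex y q := by
  classical
  let T : Finset (Fin (m + 1)) := {j | q j ≠ 0}
  obtain ⟨p', hp', hp''⟩ := nerveSimplex_eq_of_reference x p y T fun i hi => by
    have : stdSimplex.map x p (x i) ≠ 0 := (stdSimplex_map_ne_zero_iff _ _ _).2 ⟨i, hi, rfl⟩
    rw [h] at this
    obtain ⟨j, hj, hji⟩ := (stdSimplex_map_ne_zero_iff _ _ _).1 this
    exact ⟨j, by simpa [T] using hj, hji⟩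
  obtain ⟨q', hq', hq''⟩ := nerveSimplex_eq_of_reference y q y T fun j hj =>
    ⟨j, by simpa [T] using hj, rfl⟩
  rw [hp', hq']
  congr 1
  ext j
  by_cases hj : j ∈ T ∧ ∀ k ∈ T, y k = y j → k ≤ j
  · rw [(hp'' j).1 hj, (hq'' j).1 hj, h]
  · rw [(hp'' j).2 hj, (hq'' j).2 hj]

lemma nerveCoord_injective : Function.Injective (nerveCoord (P := P)) := by
  intro z w h
  obtain ⟨n, x, p, rfl⟩ := exists_nerveSimplex_eq z
  obtain ⟨m, y, q, rfl⟩ := exists_nerveSimplex_eq w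
  rw [nerveCoord_nerveSimplex, nerveCoord_nerveSimplex] at h
  exact nerveSimplex_eq_of_map_eq h

lemma exists_map_eq_of_isChain (t : stdSimplex ℝ P) (ht : IsChain (· ≤ ·) {i | t i ≠ 0}) :
    ∃ (y : Fin (Fintype.card P + 1) →o P) (q : stdSimplex ℝ (Fin (Fintype.card P + 1))),
      stdSimplex.map y q = t := by
  classical
  let S : Finset (LinearExtension P) := ({i | t i ≠ 0} : Finset P)
  have hS : ∀ i, i ∈ S ↔ t i ≠ 0 := fun i => by
    exact Finset.mem_filter_univ (α := P) i
  obtain ⟨i₀, hi₀⟩ := stdSimplex_exists_ne_zero t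
  obtain ⟨n, hn⟩ : ∃ n, S.card = n + 1 :=
    Nat.exists_eq_succ_of_ne_zero (Finset.card_ne_zero.2 ⟨i₀, (hS i₀).2 hi₀⟩)
  have hnP : n + 1 ≤ Fintype.card P := hn ▸ Finset.card_le_univ (α := P) _
  let f := S.orderEmbOfFin hn
  have hf : Monotone (β := P) f := by
    intro i j hij
    have hi := (hS _).1 (S.orderEmbOfFin_mem hn i)
    have hj := (hS _).1 (S.orderEmbOfFin_mem hn j)
    rcases ht.total hi hj with h | h
    · exact h
    · have h' : f j ≤ f i := (toLinearExtension (α := P)).monotone' h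
      exact le_of_eq (α := P) (le_antisymm (α := LinearExtension P) (f.monotone hij) h')
  let y : Fin (Fintype.card P + 1) →o P :=
    ⟨fun i => f ⟨min i n, by omega⟩, fun i j hij =>
      hf (by simp only [Fin.mk_le_mk]; exact min_le_min hij le_rfl)⟩
  have hy : ∀ i, ∃ k, t i ≠ 0 → y k = i := by
    intro i
    by_cases hi : t i = 0
    · exact ⟨0, fun h => absurd hi h⟩
    · have : i ∈ Set.range f := by
        rw [Finset.range_orderEmbOfFin]
        exact (hS i).2 hi
      obtain ⟨k, hk⟩ := this
      refine ⟨⟨k, by omega⟩, fun _ => ?_⟩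
      rw [← hk]
      change f _ = f k
      congr 1
      ext
      simp
      omega
  choose g hg using hy
  refine ⟨y, stdSimplex.map g t, ?_⟩
  rw [stdSimplex.map_comp_apply]
  conv_rhs => rw [← stdSimplex.map_id_apply t]
  exact stdSimplex_map_congr t hg

lemma nerveCoord_isChain (z : SSet.toTop.obj (nerve P)) :
    IsChain (· ≤ ·) {i | nerveCoord z i ≠ 0} := by
  obtain ⟨n, x, p, rfl⟩ := exists_nerveSimplex_eq z
  rw [nerveCoord_nerveSimplex]
  intro i hi j hj _
  obtain ⟨i, _, rfl⟩ := (stdSimplex_map_ne_zero_iff _ _ _).1 hi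
  obtain ⟨j, _, rfl⟩ := (stdSimplex_map_ne_zero_iff _ _ _).1 hj
  exact (le_total i j).imp (fun h => x.monotone h) (fun h => x.monotone h)

instance : CompactSpace (SSet.toTop.obj (nerve P)) := by
  have : Finite (Fin (Fintype.card P + 1) →o P) :=
    Finite.of_injective _ (DFunLike.coe_injective (F := Fin (Fintype.card P + 1) →o P))
  let F : (Σ _ : Fin (Fintype.card P + 1) →o P, stdSimplex ℝ (Fin (Fintype.card P + 1))) →
      SSet.toTop.obj (nerve P) := fun w => nerveSimplex w.1 w.2
  have hF : Continuous F := continuous_sigma fun x => (nerveSimplex x).continuous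
  have hs : Function.Surjective F := by
    intro z
    obtain ⟨y, q, h⟩ := exists_map_eq_of_isChain (nerveCoord z) (nerveCoord_isChain z)
    refine ⟨⟨y, q⟩, nerveCoord_injective ?_⟩
    rw [← h]
    exact nerveCoord_nerveSimplex y q
  exact ⟨hs.range_eq ▸ isCompact_range hF⟩

/-- The realization of the nerve of a finite poset is its classical order complex. -/
lemma nonempty_nerve_homeomorph :
    Nonempty (SSet.toTop.obj (nerve P) ≃ₜ
      orderComplex (Set.univ : Set P)) := by
  let F : SSet.toTop.obj (nerve P) → (P → ℝ) := fun z => (nerveCoord z).1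
  have hF : Topology.IsClosedEmbedding F :=
    (continuous_subtype_val.comp nerveCoord.hom.continuous).isClosedEmbedding
      (Subtype.val_injective.comp nerveCoord_injective)
  refine ⟨hF.isEmbedding.toHomeomorph.trans (.setCongr ?_)⟩
  ext t
  constructor
  · rintro ⟨z, rfl⟩
    exact ⟨(nerveCoord z).2, nerveCoord_isChain z, Set.subset_univ _⟩
  · rintro ⟨ht, hc, -⟩
    obtain ⟨y, q, h⟩ := exists_map_eq_of_isChain ⟨t, ht⟩ hc
    refine ⟨nerveSimplex y q, ?_⟩
    change (nerveCoord _).1 = t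
    rw [nerveCoord_nerveSimplex, h]

end OrderComplex

section Regions

lemma sign_add_mem {s : Set SignType} (hs : s.OrdConnected) {x y : ℝ}
    (hx : SignType.sign x ∈ s) (hy : SignType.sign y ∈ s) : SignType.sign (x + y) ∈ s := by
  have key : ∀ {u v : ℝ}, SignType.sign u ≤ SignType.sign v →
      SignType.sign u ≤ SignType.sign (u + v) ∧ SignType.sign (u + v) ≤ SignType.sign v := by
    intro u v huv
    refine ⟨?_, ?_⟩
    · rcases lt_trichotomy u 0 with hu | rfl | hu
      · rw [sign_neg hu]
        exact bot_le
      · simpa using huv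
      · have hv : 0 < v := by
          rw [sign_pos hu] at huv
          exact sign_eq_one_iff.1 (le_antisymm le_top huv)
        rw [sign_pos hu, sign_pos (add_pos hu hv)]
    · rcases lt_trichotomy v 0 with hv | rfl | hv
      · have hu : u < 0 := by
          rw [sign_neg hv] at huv
          exact sign_eq_neg_one_iff.1 (le_antisymm huv bot_le)
        rw [sign_neg hv, sign_neg (add_neg hu hv)]
      · simpa using huv
      · rw [sign_pos hv]
        exact le_top
  rcases le_total (SignType.sign x) (SignType.sign y) with h | h
  · exact hs.out hx hy (key h)
  · rw [add_comm]
    exact hs.out hy hx (key h)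

lemma sign_add_eq_of_same_side {s : Set SignType} (hs : s ⊆ Set.Ici 0 ∨ s ⊆ Set.Iic 0) {x y : ℝ}
    (hx : SignType.sign x ∈ s) (hy : SignType.sign y ∈ s) :
    SignType.sign x = 0 ∨ SignType.sign x = SignType.sign (x + y) := by
  rcases hs with h | h
  · have hx' : 0 ≤ x := sign_nonneg_iff.1 (h hx)
    have hy' : 0 ≤ y := sign_nonneg_iff.1 (h hy)
    rcases hx'.eq_or_lt with rfl | hx'
    · simp
    · rw [sign_pos hx', sign_pos (by linarith)]
      simp
  · have hx' : x ≤ 0 := sign_nonpos_iff.1 (h hx)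
    have hy' : y ≤ 0 := sign_nonpos_iff.1 (h hy)
    rcases hx'.eq_or_lt with rfl | hx'
    · simp
    · rw [sign_neg hx', sign_neg (by linarith)]
      simp

variable {d : ℕ} {ι : Type} {a : ι → Fin d → ℝ} {N Z P : Set ι}

lemma evalForm_add (i : ι) (x y : Fin d → ℝ) :
    evalForm a i (x + y) = evalForm a i x + evalForm a i y := by
  simp [evalForm, mul_add, Finset.sum_add_distrib]

lemma evalForm_smul (i : ι) (r : ℝ) (x : Fin d → ℝ) :
    evalForm a i (r • x) = r * evalForm a i x := by
  simp [evalForm, Finset.mul_sum, mul_left_comm]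

instance [Finite ι] : Finite (DeltaPoset a N Z P) :=
  inferInstanceAs (Finite {σ : ι → SignType // IsFace a σ ∧ (∀ i ∈ N, σ i = -1) ∧
    (∀ i ∈ Z, σ i = 0) ∧ (∀ i ∈ P, σ i = 1)})

/-- The signs at the `i`-th hyperplane that are allowed by the prescription `(N, Z, P)`. -/
def allowedSigns (N Z P : Set ι) (i : ι) : Set SignType :=
  {s | (i ∈ N → s = -1) ∧ (i ∈ Z → s = 0) ∧ (i ∈ P → s = 1)}

lemma ordConnected_allowedSigns (i : ι) : (allowedSigns N Z P i).OrdConnected := by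
  refine ⟨fun s hs t ht u hu => ⟨fun h => ?_, fun h => ?_, fun h => ?_⟩⟩
  · exact le_antisymm (hu.2.trans (ht.1 h).le) ((hs.1 h).ge.trans hu.1)
  · exact le_antisymm (hu.2.trans (ht.2.1 h).le) ((hs.2.1 h).ge.trans hu.1)
  · exact le_antisymm (hu.2.trans (ht.2.2 h).le) ((hs.2.2 h).ge.trans hu.1)

variable (a N Z P) in
/-- The faces in `Δ(A; N, Z, P)` whose signs satisfy the constraints `c`. -/
def region (c : ι → Set SignType) : Set (DeltaPoset a N Z P) :=
  {σ | ∀ i, σ.1 i ∈ c i}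

lemma region_update [DecidableEq ι] (c : ι → Set SignType) (i : ι) (B : Set SignType) :
    region a N Z P (Function.update c i (c i ∩ B)) = region a N Z P c ∩ {σ | σ.1 i ∈ B} := by
  ext σ
  constructor
  · intro h
    have hi := h i
    rw [Function.update_self] at hi
    refine ⟨fun j => ?_, hi.2⟩
    by_cases hj : j = i
    · exact hj ▸ hi.1
    · have := h j
      rwa [Function.update_of_ne hj] at this
  · rintro ⟨h, hi⟩ j
    by_cases hj : j = i
    · subst hj
      rw [Function.update_self]
      exact ⟨h j, hi⟩
    · rw [Function.update_of_ne hj]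
      exact h j

lemma exists_mem_region {c : ι → Set SignType} (hc : ∀ i, c i ⊆ allowedSigns N Z P i)
    (x : Fin d → ℝ) (hx : ∀ i, SignType.sign (evalForm a i x) ∈ c i) :
    ∃ σ ∈ region a N Z P c, ∀ i, SignType.sign (evalForm a i x) = σ.1 i :=
  ⟨⟨fun i => SignType.sign (evalForm a i x), ⟨x, fun _ => rfl⟩, fun i => (hc i (hx i)).1,
    fun i => (hc i (hx i)).2.1, fun i => (hc i (hx i)).2.2⟩, hx, fun _ => rfl⟩

lemma exists_mem_region_eq_zero {c : ι → Set SignType} (hc : ∀ i, c i ⊆ allowedSigns N Z P i)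
    (hoc : ∀ i, (c i).OrdConnected) {σ τ : DeltaPoset a N Z P} (hσ : σ ∈ region a N Z P c)
    (hτ : τ ∈ region a N Z P c) {i : ι} (hσi : 0 ≤ σ.1 i) (hτi : τ.1 i ≤ 0) :
    ∃ ρ ∈ region a N Z P c, ρ.1 i = 0 := by
  rcases hσi.eq_or_lt with h | hσi
  · exact ⟨σ, hσ, h.symm⟩
  rcases hτi.eq_or_lt with h | hτi
  · exact ⟨τ, hτ, h⟩
  obtain ⟨x, hx⟩ := σ.2.1
  obtain ⟨y, hy⟩ := τ.2.1
  have hu : 0 < evalForm a i x := by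
    by_contra! h
    exact hσi.not_ge (hx i ▸ sign_nonpos_iff.2 h)
  have hv : 0 < - evalForm a i y := by
    by_contra! h
    exact hτi.not_ge (hy i ▸ sign_nonneg_iff.2 (neg_nonpos.1 h))
  obtain ⟨ρ, hρ, hρz⟩ := exists_mem_region hc
    ((- evalForm a i y) • x + evalForm a i x • y) (fun j => by
      rw [evalForm_add, evalForm_smul, evalForm_smul]
      apply sign_add_mem (hoc j)
      · rw [sign_mul, sign_pos hv, one_mul, hx]
        exact hσ j
      · rw [sign_mul, sign_pos hu, one_mul, hy]
        exact hτ j)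
  refine ⟨ρ, hρ, ?_⟩
  rw [← hρz, evalForm_add, evalForm_smul, evalForm_smul, sign_eq_zero_iff]
  ring

lemma exists_isGreatest_region [Finite ι] {c : ι → Set SignType}
    (hc : ∀ i, c i ⊆ allowedSigns N Z P i) (hoc : ∀ i, (c i).OrdConnected)
    (hside : ∀ i, c i ⊆ Set.Ici 0 ∨ c i ⊆ Set.Iic 0) (hne : (region a N Z P c).Nonempty) :
    ∃ m, IsGreatest (region a N Z P c) m := by
  obtain ⟨m, hm⟩ := (Set.toFinite (region a N Z P c)).exists_maximal hne
  refine ⟨m, hm.prop, fun σ hσ => ?_⟩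
  obtain ⟨x, hx⟩ := m.2.1
  obtain ⟨y, hy⟩ := σ.2.1
  have hxc : ∀ i, SignType.sign (evalForm a i x) ∈ c i := fun i => hx i ▸ hm.prop i
  have hyc : ∀ i, SignType.sign (evalForm a i y) ∈ c i := fun i => hy i ▸ hσ i
  obtain ⟨ρ, hρ, hρz⟩ := exists_mem_region hc (x + y) fun i => by
    rw [evalForm_add]
    exact sign_add_mem (hoc i) (hxc i) (hyc i)
  have hmρ : m ≤ ρ := fun i => by
    rw [← hρz, ← hx, evalForm_add]
    exact sign_add_eq_of_same_side (hside i) (hxc i) (hyc i)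
  have hσρ : σ ≤ ρ := fun i => by
    rw [← hρz, ← hy, evalForm_add, add_comm]
    exact sign_add_eq_of_same_side (hside i) (hyc i) (hxc i)
  exact hσρ.trans (hm.le_of_ge hρ hmρ)

lemma isChain_same_side {C : Set (DeltaPoset a N Z P)} (hC : IsChain (· ≤ ·) C) (i : ι) :
    (∀ σ ∈ C, 0 ≤ σ.1 i) ∨ (∀ σ ∈ C, σ.1 i ≤ 0) := by
  by_contra! h
  obtain ⟨⟨σ, hσ, hσi⟩, ⟨τ, hτ, hτi⟩⟩ := h
  rcases hC.total hσ hτ with h | h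
  · rcases h i with h | h
    · exact hσi.ne h
    · exact (hσi.trans hτi).ne h
  · rcases h i with h | h
    · exact hτi.ne' h
    · exact (hσi.trans hτi).ne' h

lemma isAbsoluteExtensor_orderComplex_region (X : Type*) [PseudoEMetricSpace X]
    [Finite ι] [Fintype (DeltaPoset a N Z P)] (s : Finset ι) (c : ι → Set SignType)
    (hc : ∀ i, c i ⊆ allowedSigns N Z P i) (hoc : ∀ i, (c i).OrdConnected)
    (hside : ∀ i ∉ s, c i ⊆ Set.Ici 0 ∨ c i ⊆ Set.Iic 0) (hne : (region a N Z P c).Nonempty) :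
    IsAbsoluteExtensor X (orderComplex (region a N Z P c)) := by
  classical
  induction s using Finset.induction_on generalizing c with
  | empty =>
    obtain ⟨m, hm⟩ := exists_isGreatest_region hc hoc (fun i => hside i (by simp)) hne
    exact isAbsoluteExtensor_orderComplex_of_isGreatest X hm
  | insert i s _ ih =>
    have key : ∀ B : Set SignType, B.OrdConnected → (B ⊆ Set.Ici 0 ∨ B ⊆ Set.Iic 0) →
        (region a N Z P c ∩ {σ | σ.1 i ∈ B}).Nonempty →
        IsAbsoluteExtensor X (orderComplex (region a N Z P c ∩ {σ | σ.1 i ∈ B})) := by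
      intro B hB hBs hBne
      rw [← region_update] at hBne ⊢
      refine ih _ (fun j => ?_) (fun j => ?_) (fun j hj => ?_) hBne
      all_goals
        by_cases hji : j = i
        · subst hji
          rw [Function.update_self]
          first
          | exact Set.inter_subset_left.trans (hc j)
          | exact (hoc j).inter hB
          | exact hBs.imp Set.inter_subset_right.trans Set.inter_subset_right.trans
        · rw [Function.update_of_ne hji]
          first
          | exact hc j
          | exact hoc j
          | exact hside j (by simp [hji, hj])
    let U := region a N Z P c ∩ {σ | σ.1 i ∈ Set.Ici 0}
    let V := region a N Z P c ∩ {σ | σ.1 i ∈ Set.Iic 0}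
    have hUV : U ∪ V = region a N Z P c := by
      rw [← Set.inter_union_distrib_left, Set.inter_eq_left]
      exact fun σ _ => le_total 0 (σ.1 i)
    have hinter : U ∩ V = region a N Z P c ∩ {σ | σ.1 i ∈ Set.Icc 0 0} := by
      rw [← Set.inter_inter_distrib_left]
      rfl
    have keyU := key (Set.Ici 0) Set.ordConnected_Ici (Or.inl subset_rfl)
    have keyV := key (Set.Iic 0) Set.ordConnected_Iic (Or.inr subset_rfl)
    rcases Set.eq_empty_or_nonempty U with hU | hU
    · rw [hU, Set.empty_union] at hUV
      rw [← hUV] at hne ⊢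
      exact keyV hne
    rcases Set.eq_empty_or_nonempty V with hV | hV
    · rw [hV, Set.union_empty] at hUV
      rw [← hUV] at hne ⊢
      exact keyU hne
    rw [← hUV]
    refine IsAbsoluteExtensor.orderComplex_union (fun C hC hCR => ?_) (keyU hU) (keyV hV) ?_
    · rw [hUV] at hCR
      exact (isChain_same_side hC i).imp (fun h σ hσ => ⟨hCR hσ, h σ hσ⟩)
        (fun h σ hσ => ⟨hCR hσ, h σ hσ⟩)
    · rw [hinter]
      refine key (Set.Icc 0 0) Set.ordConnected_Icc (Or.inl Set.Icc_subset_Ici_self) ?_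
      obtain ⟨σ, hσ, hσi⟩ := hU
      obtain ⟨τ, hτ, hτi⟩ := hV
      obtain ⟨ρ, hρ, hρi⟩ := exists_mem_region_eq_zero hc hoc hσ hτ hσi hτi
      exact ⟨ρ, hρ, hρi.ge, hρi.le⟩

end Regions

/-- Let `A` be a nonempty finite central complexified arrangement of
hyperplanes in `ℝ^d` and `N, Z, P ⊆ A` pairwise disjoint.  If `Δ(A; N, Z, P)` is
nonempty, then its order complex (the geometric realization of its nerve) is
contractible. -/
theorem delta_poset_contractible {d : ℕ} {ι : Type} [Fintype ι] [Nonempty ι]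
    (a : ι → Fin d → ℝ) (ha : ∀ i, a i ≠ 0) (N Z P : Set ι)
    (hNZ : Disjoint N Z) (hNP : Disjoint N P) (hZP : Disjoint Z P)
    (hne : Nonempty (DeltaPoset a N Z P)) :
    ContractibleSpace (SSet.toTop.obj (nerve (DeltaPoset a N Z P))) := by
  classical
  have : Fintype (DeltaPoset a N Z P) := Fintype.ofFinite _
  have hregion : region a N Z P (allowedSigns N Z P) = Set.univ :=
    Set.eq_univ_of_forall fun σ i => ⟨σ.2.2.1 i, σ.2.2.2.1 i, σ.2.2.2.2 i⟩
  have hAE := isAbsoluteExtensor_orderComplex_region (a := a)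
    ((DeltaPoset a N Z P → ℝ) × ℝ) Finset.univ (allowedSigns N Z P) (fun _ => subset_rfl)
    ordConnected_allowedSigns (fun i hi => absurd (Finset.mem_univ i) hi)
    (hregion ▸ Set.univ_nonempty)
  rw [hregion] at hAE
  obtain ⟨e⟩ := nonempty_nerve_homeomorph (P := DeltaPoset a N Z P)
  obtain ⟨σ⟩ := hne
  have := hAE.contractibleSpace (isClosed_orderComplex _)
    ⟨Pi.single σ 1, single_mem_orderComplex (Set.mem_univ σ)⟩
  exact e.contractibleSpace
end
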